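/- For every ℓ ≥ 1 there exists n ∈ ℕ such that: for every coset n-acyclic Cayley group G with generator set E, all vertices v_1, v_{ℓ+1} ∈ G, every γ ⊆ gen(v_1, v_{ℓ+1}), and t = ρ(v_{ℓ+1}, γ): if v_1, α_1, v_2, α_2, …, v_ℓ, α_ℓ, v_{ℓ+1} is a non-t coset path of length ℓ in G, then the sequence of dual-hypergraph vertices (∅, [v_1]_∅), (α_1, [v_2]_{α_1}), (α_2, [v_3]_{α_2}), …, (α_ℓ, [v_{ℓ+1}]_{α_ℓ}), (∅, [v_{ℓ+1}]_∅) is a chordless path of length ℓ+1 in the Gaifman graph of d(G) restricted to d(V) \ t: its vertices are pairwise distinct and avoid t, consecutive vertices are joined via the hyperedges ⟦v_1⟧, …, ⟦v_{ℓ+1}⟧ respectively, and no hyperedge ⟦w⟧ (w ∈ G) contains two vertices of the path that are not consecutive on it. -/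

import Mathlib

open scoped Pointwise

section CayleyDefs

variable {G : Type*} [Group G]

/-- The `α`-coset of `v`, i.e. `v · ⟨α⟩` where `⟨α⟩` is the subgroup generated by `α`. -/
def coset (v : G) (α : Set G) : Set G := {x | v⁻¹ * x ∈ Subgroup.closure α}

/-- `G` together with the generator set `E` is a Cayley group: every element of `E`
is a non-trivial involution and `E` generates `G`. -/
def IsCayley (E : Set G) : Prop :=
  (∀ e ∈ E, e ≠ 1 ∧ e * e = 1) ∧ Subgroup.closure E = ⊤

/-- A coset cycle of length `m` in the Cayley group `G` with generator set `E`. -/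
def IsCosetCycle (E : Set G) (m : ℕ) (v : ZMod m → G) (α : ZMod m → Set G) : Prop :=
  (∀ i, α i ⊆ E) ∧
  (∀ i, (v i)⁻¹ * v (i + 1) ∈ Subgroup.closure (α i)) ∧
  (∀ i, coset (v i) (α (i - 1) ∩ α i) ∩ coset (v (i + 1)) (α i ∩ α (i + 1)) = ∅)

/-- Coset `n`-acyclic: no coset cycle of length `≤ n`. -/
def CosetAcyclic (E : Set G) (n : ℕ) : Prop :=
  ∀ m, 1 ≤ m → m ≤ n → ∀ (v : ZMod m → G) (α : ZMod m → Set G), ¬ IsCosetCycle E m v α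

/-- 2-acyclic: no coset cycle of length 2. -/
def TwoAcyclic (E : Set G) : Prop :=
  ∀ (v : ZMod 2 → G) (α : ZMod 2 → Set G), ¬ IsCosetCycle E 2 v α

/-- Labels of a path of length `ℓ`, where labels with indices outside `1..ℓ` equal `∅`. -/
def extLabel (ℓ : ℕ) (α : ℕ → Set G) (i : ℕ) : Set G :=
  if 1 ≤ i ∧ i ≤ ℓ then α i else ∅

/-- A coset path of length `ℓ ≥ 1` with vertices `v 1, …, v (ℓ+1)` and labels
`α 1, …, α ℓ` (vertices pairwise distinct except possibly `v 1 = v (ℓ+1)`;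
convention `α 0 = α (ℓ+1) = ∅`). -/
def IsCosetPath (E : Set G) (ℓ : ℕ) (v : ℕ → G) (α : ℕ → Set G) : Prop :=
  1 ≤ ℓ ∧
  (∀ i, 1 ≤ i → i ≤ ℓ → α i ⊆ E) ∧
  (∀ i j, 1 ≤ i → i < j → j ≤ ℓ + 1 → v i = v j → i = 1 ∧ j = ℓ + 1) ∧
  (∀ i, 1 ≤ i → i ≤ ℓ → (v i)⁻¹ * v (i + 1) ∈ Subgroup.closure (α i)) ∧
  (∀ i, 1 ≤ i → i ≤ ℓ →
    coset (v i) (extLabel ℓ α (i - 1) ∩ α i) ∩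
      coset (v (i + 1)) (α i ∩ extLabel ℓ α (i + 1)) = ∅)

/-- `γ` is the unique minimal generator set connecting `v` and `u`:
for every `β ⊆ E`, `u ∈ [v]_β` iff `γ ⊆ β`. -/
def IsGen (E : Set G) (v u : G) (γ : Set G) : Prop :=
  γ ⊆ E ∧ ∀ β ⊆ E, (u ∈ coset v β ↔ γ ⊆ β)

/-- The dual hyperedge `⟦v⟧`: all label-tagged cosets `(α, [v]_α)` for `α ⊆ E`. -/
def dedge (E : Set G) (v : G) : Set (Set G × Set G) :=
  {p | p.1 ⊆ E ∧ p.2 = coset v p.1}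

/-- The vertex set of the dual hypergraph: all label-tagged cosets. -/
def dualV (E : Set G) : Set (Set G × Set G) :=
  {p | p.1 ⊆ E ∧ ∃ v : G, p.2 = coset v p.1}

/-- Gaifman adjacency in the dual hypergraph: two distinct vertices lying in a
common hyperedge. -/
def dAdj (E : Set G) (x y : Set G × Set G) : Prop :=
  x ≠ y ∧ ∃ w : G, x ∈ dedge E w ∧ y ∈ dedge E w

/-- `ρ(v,γ) = { (β, [v]_β) : γ ⊆ β ⊆ E }`. -/
def rho (E : Set G) (v : G) (γ : Set G) : Set (Set G × Set G) :=
  {p | γ ⊆ p.1 ∧ p.1 ⊆ E ∧ p.2 = coset v p.1}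

/-- A non-`t` coset path for `t = ρ(w,γ)`: a coset path all of whose links `[v_i]_{α_i}`
fail to contain `[w]_γ`. -/
def IsNonTPath (E : Set G) (w : G) (γ : Set G) (ℓ : ℕ) (v : ℕ → G) (α : ℕ → Set G) : Prop :=
  IsCosetPath E ℓ v α ∧ ∀ i, 1 ≤ i → i ≤ ℓ → ¬ coset w γ ⊆ coset (v i) (α i)

/-- An inner coset path with respect to `g = gen(v 1, v (ℓ+1))`. -/
def IsInnerPath (E : Set G) (g : Set G) (ℓ : ℕ) (v : ℕ → G) (α : ℕ → Set G) : Prop :=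
  IsCosetPath E ℓ v α ∧ 2 ≤ ℓ ∧
    ∀ i, 1 ≤ i → i ≤ ℓ → coset (v i) (α i) ⊂ coset (v 1) g

/-- A non-trivial coset path with respect to `g = gen(v 1, v (ℓ+1))`. -/
def IsNontrivialPath (E : Set G) (g : Set G) (ℓ : ℕ) (v : ℕ → G) (α : ℕ → Set G) : Prop :=
  IsCosetPath E ℓ v α ∧ 2 ≤ ℓ ∧
    ∀ i, 1 ≤ i → i ≤ ℓ → ¬ coset (v 1) g ⊆ coset (v i) (α i)

/-- `n`-conformality of the dual hypergraph: every Gaifman clique of size `≤ n`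
is contained in a hyperedge. -/
def NConformal (E : Set G) (n : ℕ) : Prop :=
  ∀ K : Finset (Set G × Set G), K.card ≤ n → (↑K : Set (Set G × Set G)) ⊆ dualV E →
    (∀ x ∈ K, ∀ y ∈ K, x ≠ y → dAdj E x y) → ∃ w : G, ∀ x ∈ K, x ∈ dedge E w

/-- `n`-chordality of the dual hypergraph: every Gaifman cycle of length `> 3`
and `≤ n` has a chord. -/
def NChordal (E : Set G) (n : ℕ) : Prop :=
  ∀ m, 4 ≤ m → m ≤ n → ∀ c : ZMod m → Set G × Set G, Function.Injective c →
    (∀ i, c i ∈ dualV E) → (∀ i, dAdj E (c i) (c (i + 1))) →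
    ∃ i j : ZMod m, i ≠ j ∧ j ≠ i + 1 ∧ i ≠ j + 1 ∧ dAdj E (c i) (c j)

/-- A walk of length `k` in the Gaifman graph of the dual hypergraph restricted to
the complement of `t = ρ(v,γ)`, from a vertex of `⟦v⟧ \ t` to a vertex of `⟦u⟧ \ t`. -/
def HWalk (E : Set G) (v : G) (γ : Set G) (u : G) (k : ℕ) (c : ℕ → Set G × Set G) : Prop :=
  c 0 ∈ dedge E v ∧ c k ∈ dedge E u ∧
  (∀ i ≤ k, c i ∈ dualV E ∧ c i ∉ rho E v γ) ∧
  ∀ i < k, dAdj E (c i) (c (i + 1))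

/-- The sequence of dual-hypergraph vertices induced by a coset path:
`(∅,[v 1]_∅), (α 1, [v 2]_{α 1}), …, (α ℓ, [v (ℓ+1)]_{α ℓ}), (∅, [v (ℓ+1)]_∅)`. -/
def pathVert (ℓ : ℕ) (v : ℕ → G) (α : ℕ → Set G) (i : ℕ) : Set G × Set G :=
  if i = 0 then (∅, coset (v 1) ∅)
  else if i ≤ ℓ then (α i, coset (v (i + 1)) (α i))
  else (∅, coset (v (ℓ + 1)) ∅)

end CayleyDefs


section CosetLemmas

variable {G : Type*} [Group G]

theorem mem_coset {v x : G} {α : Set G} : x ∈ coset v α ↔ v⁻¹ * x ∈ Subgroup.closure α :=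
  Iff.rfl

theorem mem_coset_self (v : G) (α : Set G) : v ∈ coset v α := by
  simp [mem_coset]

theorem mem_coset_symm {v x : G} {α : Set G} (h : x ∈ coset v α) : v ∈ coset x α := by
  rw [mem_coset] at *
  simpa using inv_mem h

theorem mem_coset_trans {v x y : G} {α : Set G} (h : x ∈ coset v α) (h' : y ∈ coset x α) :
    y ∈ coset v α := by
  rw [mem_coset] at *
  simpa [mul_assoc] using mul_mem h h'

theorem coset_mono {v : G} {α β : Set G} (h : α ⊆ β) : coset v α ⊆ coset v β :=
  fun _ hx => Subgroup.closure_mono h hx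

theorem coset_eq_of_mem {v x : G} {α : Set G} (h : x ∈ coset v α) : coset x α = coset v α :=
  Set.Subset.antisymm (fun _ hy => mem_coset_trans h hy)
    (fun _ hy => mem_coset_trans (mem_coset_symm h) hy)

theorem mem_coset_empty {v x : G} : x ∈ coset v ∅ ↔ x = v := by
  rw [mem_coset, Subgroup.closure_empty, Subgroup.mem_bot, inv_mul_eq_one, eq_comm]

/-- In a group without coset cycles of length 2, cosets through a common vertex intersect in the
coset of the intersection of their labels. -/
theorem CosetAcyclic.mem_coset_inter {E : Set G} {n : ℕ} (hn : 2 ≤ n) (hE : CosetAcyclic E n)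
    {α β : Set G} (hα : α ⊆ E) (hβ : β ⊆ E) {v x : G} (h₁ : x ∈ coset v α)
    (h₂ : x ∈ coset v β) : x ∈ coset v (α ∩ β) := by
  by_contra hx
  have key : coset v (α ∩ β) ∩ coset x (α ∩ β) = ∅ := by
    rw [Set.eq_empty_iff_forall_notMem]
    rintro y ⟨hy, hy'⟩
    exact hx (mem_coset_trans hy (mem_coset_symm hy'))
  refine hE 2 (by norm_num) hn ![v, x] ![α, β] ⟨?_, ?_, ?_⟩
  · intro i
    fin_cases i
    · exact hα
    · exact hβ
  · intro i
    fin_cases i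
    · exact h₁
    · exact mem_coset_symm h₂
  · intro i
    fin_cases i
    · change coset v (β ∩ α) ∩ coset x (α ∩ β) = ∅
      rwa [Set.inter_comm β α]
    · change coset x (α ∩ β) ∩ coset v (β ∩ α) = ∅
      rwa [Set.inter_comm β α, Set.inter_comm]

/-- A coset cycle of length `m + 3` presented by families indexed by natural numbers. -/
theorem isCosetCycle_of_nat {E : Set G} {m : ℕ} {v : ℕ → G} {α : ℕ → Set G}
    (hα : ∀ k ≤ m + 2, α k ⊆ E)
    (hv : ∀ k ≤ m + 1, v (k + 1) ∈ coset (v k) (α k))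
    (hv_last : v 0 ∈ coset (v (m + 2)) (α (m + 2)))
    (hd : ∀ k ≤ m,
      coset (v (k + 1)) (α k ∩ α (k + 1)) ∩ coset (v (k + 2)) (α (k + 1) ∩ α (k + 2)) = ∅)
    (hd_last : coset (v (m + 2)) (α (m + 1) ∩ α (m + 2)) ∩
      coset (v 0) (α (m + 2) ∩ α 0) = ∅)
    (hd_zero : coset (v 0) (α (m + 2) ∩ α 0) ∩ coset (v 1) (α 0 ∩ α 1) = ∅) :
    IsCosetCycle E (m + 3) (fun i => v i.val) (fun i => α i.val) := by
  have val_succ : ∀ i : ZMod (m + 3), (i + 1).val = if i.val = m + 2 then 0 else i.val + 1 := by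
    intro i
    have hi := ZMod.val_lt i
    have h1 : (1 : ZMod (m + 3)).val = 1 := ZMod.val_one'' (by omega)
    rw [ZMod.val_add, h1]
    split_ifs with h
    · simp [h]
    · exact Nat.mod_eq_of_lt (by omega)
  refine ⟨fun i => hα _ (by have := ZMod.val_lt i; omega), fun i => ?_, fun i => ?_⟩
  · have hi := ZMod.val_lt i
    simp only [val_succ]
    split_ifs with h
    · rw [h]
      exact hv_last
    · exact hv _ (by omega)
  · obtain ⟨j, rfl⟩ : ∃ j, i = j + 1 := ⟨i - 1, by ring⟩
    have hj := ZMod.val_lt j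
    simp only [val_succ, add_sub_cancel_right]
    rcases (by omega : j.val ≤ m ∨ j.val = m + 1 ∨ j.val = m + 2) with h | h | h
    · simpa [show j.val ≠ m + 2 by omega, show j.val ≠ m + 1 by omega] using hd _ h
    · simpa [h] using hd_last
    · simpa [h] using hd_zero

/-- Two non-consecutive links of a coset path do not meet. -/
theorem CosetAcyclic.links_disjoint {E : Set G} {n ℓ : ℕ} (hn : ℓ + 2 ≤ n)
    (hE : CosetAcyclic E n) {v : ℕ → G} {α : ℕ → Set G} (hα : ∀ k, α k ⊆ E)
    (hv : ∀ k, 1 ≤ k → k ≤ ℓ → v (k + 1) ∈ coset (v k) (α k))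
    (hd : ∀ k, k + 1 ≤ ℓ →
      coset (v (k + 1)) (α k ∩ α (k + 1)) ∩ coset (v (k + 2)) (α (k + 1) ∩ α (k + 2)) = ∅)
    (m i : ℕ) (him : i + m + 1 ≤ ℓ) (w : G) (hi : w ∈ coset (v (i + 1)) (α i))
    (hj : w ∈ coset (v (i + m + 2)) (α (i + m + 2))) : False := by
  induction m generalizing i w with
  | zero =>
    have hstep := hv (i + 1) (by omega) (by omega)
    have hempty := Set.eq_empty_iff_forall_notMem.mp (hd i (by omega))
    refine hE 3 (by norm_num) (by omega) _ _ (isCosetCycle_of_nat (m := 0)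
      (v := fun k => if k = 0 then w else v (i + k)) (α := fun k => α (i + k))
      (fun k _ => hα _) ?_ ?_ ?_ ?_ ?_)
    · intro k hk
      rcases (by omega : k = 0 ∨ k = 1) with rfl | rfl
      · exact mem_coset_symm hi
      · exact hstep
    · exact hj
    · intro k hk
      obtain rfl : k = 0 := by omega
      exact hd i (by omega)
    · rw [Set.eq_empty_iff_forall_notMem]
      rintro x ⟨hx : x ∈ coset (v (i + 2)) (α (i + 1) ∩ α (i + 2)),
        hx' : x ∈ coset w (α (i + 2) ∩ α i)⟩
      refine hempty x ⟨hE.mem_coset_inter (by omega) (hα _) (hα _) ?_ ?_, hx⟩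
      · exact mem_coset_trans hi (coset_mono Set.inter_subset_right hx')
      · exact mem_coset_trans hstep (coset_mono Set.inter_subset_left hx)
    · rw [Set.eq_empty_iff_forall_notMem]
      rintro x ⟨hx : x ∈ coset w (α (i + 2) ∩ α i),
        hx' : x ∈ coset (v (i + 1)) (α i ∩ α (i + 1))⟩
      refine hempty x ⟨hx', hE.mem_coset_inter (by omega) (hα _) (hα _) ?_ ?_⟩
      · exact mem_coset_trans (mem_coset_symm hstep) (coset_mono Set.inter_subset_right hx')
      · exact mem_coset_trans hj (coset_mono Set.inter_subset_left hx)
  | succ m ih =>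
    refine hE (m + 1 + 3) (by omega) (by omega) _ _ (isCosetCycle_of_nat (m := m + 1)
      (v := fun k => if k = 0 then w else v (i + k)) (α := fun k => α (i + k))
      (fun k _ => hα _) ?_ ?_ ?_ ?_ ?_)
    · intro k hk
      rcases k with _ | k
      · exact mem_coset_symm hi
      · exact hv (i + (k + 1)) (by omega) (by omega)
    · exact hj
    · intro k hk
      exact hd (i + k) (by omega)
    · rw [Set.eq_empty_iff_forall_notMem]
      rintro x ⟨hx : x ∈ coset (v (i + m + 3)) (α (i + m + 2) ∩ α (i + m + 3)),
        hx' : x ∈ coset w (α (i + m + 3) ∩ α i)⟩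
      refine ih i (by omega) x
        (mem_coset_trans hi (coset_mono Set.inter_subset_right hx')) ?_
      exact mem_coset_trans (hv (i + m + 2) (by omega) (by omega))
        (coset_mono Set.inter_subset_left hx)
    · rw [Set.eq_empty_iff_forall_notMem]
      rintro x ⟨hx : x ∈ coset w (α (i + m + 3) ∩ α i),
        hx' : x ∈ coset (v (i + 1)) (α i ∩ α (i + 1))⟩
      refine ih (i + 1) (by omega) x ?_ ?_
      · exact mem_coset_trans (mem_coset_symm (hv (i + 1) (by omega) (by omega)))
          (coset_mono Set.inter_subset_right hx')
      · rw [show i + 1 + m + 2 = i + m + 3 by ring]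
        exact mem_coset_trans hj (coset_mono Set.inter_subset_left hx)

end CosetLemmas

universe u

/-- for every `ℓ ≥ 1` there is `n` such that in every coset `n`-acyclic
Cayley group, for `γ ⊆ gen(v_1, v_{ℓ+1})` and `t = ρ(v_{ℓ+1},γ)`: every non-`t` coset
path `v_1, α_1, …, α_ℓ, v_{ℓ+1}` of length `ℓ` induces a chordless path
`(∅,[v_1]_∅), (α_1,[v_2]_{α_1}), …, (α_ℓ,[v_{ℓ+1}]_{α_ℓ}), (∅,[v_{ℓ+1}]_∅)` of length `ℓ+1`
in the Gaifman graph of `d(G)` restricted to `d(V) ∖ t`, joined via the hyperedges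
`⟦v_1⟧, …, ⟦v_{ℓ+1}⟧`. -/
theorem coset_to_chordless (ℓ : ℕ) (hℓ : 1 ≤ ℓ) :
    ∃ n : ℕ, ∀ (G : Type u) [Group G] (E : Set G), IsCayley E → CosetAcyclic E n →
      ∀ (vs : ℕ → G) (α : ℕ → Set G) (g γ : Set G),
        IsGen E (vs 1) (vs (ℓ + 1)) g → γ ⊆ g →
        IsNonTPath E (vs (ℓ + 1)) γ ℓ vs α →
        (∀ i j, i ≤ ℓ + 1 → j ≤ ℓ + 1 → i ≠ j →
            pathVert ℓ vs α i ≠ pathVert ℓ vs α j) ∧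
        (∀ i, i ≤ ℓ + 1 → pathVert ℓ vs α i ∉ rho E (vs (ℓ + 1)) γ) ∧
        (∀ i, 1 ≤ i → i ≤ ℓ + 1 →
            pathVert ℓ vs α (i - 1) ∈ dedge E (vs i) ∧ pathVert ℓ vs α i ∈ dedge E (vs i)) ∧
        (∀ (w : G) (i j : ℕ), i ≤ ℓ + 1 → j ≤ ℓ + 1 → i + 1 < j →
            ¬ (pathVert ℓ vs α i ∈ dedge E w ∧ pathVert ℓ vs α j ∈ dedge E w)) := by
  refine ⟨ℓ + 2, fun G _ E _ hE vs α _ γ _ _ ⟨⟨_, hα, _, hv, hd⟩, ht⟩ => ?_⟩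
  have label_of_mem : ∀ k, 1 ≤ k → k ≤ ℓ → extLabel ℓ α k = α k := fun k h₁ h₂ => by
    simp [extLabel, h₁, h₂]
  have label_subset : ∀ k, extLabel ℓ α k ⊆ E := by
    intro k
    unfold extLabel
    split_ifs with h
    · exact hα k h.1 h.2
    · exact Set.empty_subset E
  have step : ∀ k, 1 ≤ k → k ≤ ℓ → vs (k + 1) ∈ coset (vs k) (extLabel ℓ α k) := by
    intro k h₁ h₂
    rw [label_of_mem k h₁ h₂]
    exact hv k h₁ h₂
  have disj : ∀ k, k + 1 ≤ ℓ → ∀ x,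
      x ∈ coset (vs (k + 1)) (extLabel ℓ α k ∩ extLabel ℓ α (k + 1)) →
      x ∉ coset (vs (k + 2)) (extLabel ℓ α (k + 1) ∩ extLabel ℓ α (k + 2)) := by
    intro k hk x hx hx'
    have h := hd (k + 1) (by omega) hk
    rw [← label_of_mem (k + 1) (by omega) hk] at h
    exact Set.eq_empty_iff_forall_notMem.mp h x ⟨hx, hx'⟩
  have links := hE.links_disjoint le_rfl label_subset step (fun k hk =>
    Set.eq_empty_iff_forall_notMem.mpr fun x hx => disj k hk x hx.1 hx.2)
  have hγ_ne : γ ≠ ∅ := by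
    rintro rfl
    refine ht ℓ hℓ le_rfl fun x hx => ?_
    rw [mem_coset_empty] at hx
    subst hx
    exact hv ℓ hℓ le_rfl
  have vert_left : ∀ k ≤ ℓ, pathVert ℓ vs α k =
      (extLabel ℓ α k, coset (vs (k + 1)) (extLabel ℓ α k)) := by
    intro k hk
    rcases Nat.eq_zero_or_pos k with rfl | h
    · simp [pathVert, extLabel]
    · rw [label_of_mem k h hk]
      simp [pathVert, h.ne', hk]
  have vert_right : ∀ k, 1 ≤ k → k ≤ ℓ + 1 → pathVert ℓ vs α k =
      (extLabel ℓ α k, coset (vs k) (extLabel ℓ α k)) := by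
    intro k h₁ h₂
    rcases Nat.lt_or_ge ℓ k with h | h
    · obtain rfl : k = ℓ + 1 := by omega
      simp [pathVert, extLabel]
    · rw [vert_left k h, coset_eq_of_mem (step k h₁ h)]
  have chordless : ∀ (w : G) (i j : ℕ), i ≤ ℓ + 1 → j ≤ ℓ + 1 → i + 1 < j →
      ¬ (pathVert ℓ vs α i ∈ dedge E w ∧ pathVert ℓ vs α j ∈ dedge E w) := by
    rintro w i j - hj hij ⟨⟨-, hwi⟩, ⟨-, hwj⟩⟩
    rw [vert_left i (by omega)] at hwi
    rw [vert_right j (by omega) hj] at hwj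
    obtain ⟨m, rfl⟩ : ∃ m, j = i + m + 2 := ⟨j - i - 2, by omega⟩
    exact links m i (by omega) w (hwi.symm.subset (mem_coset_self _ _))
      (hwj.symm.subset (mem_coset_self _ _))
  have consecutive : ∀ i, 1 ≤ i → i ≤ ℓ + 1 →
      pathVert ℓ vs α (i - 1) ∈ dedge E (vs i) ∧ pathVert ℓ vs α i ∈ dedge E (vs i) := by
    intro i h₁ h₂
    obtain ⟨k, rfl⟩ : ∃ k, i = k + 1 := ⟨i - 1, by omega⟩
    rw [Nat.add_sub_cancel, vert_left k (by omega), vert_right (k + 1) h₁ h₂]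
    exact ⟨⟨label_subset _, rfl⟩, ⟨label_subset _, rfl⟩⟩
  have distinct : ∀ i j, j ≤ ℓ + 1 → i < j → pathVert ℓ vs α i ≠ pathVert ℓ vs α j := by
    intro i j hj hij h
    rcases (by omega : i + 1 < j ∨ j = i + 1) with hlt | rfl
    · have hmem := (consecutive j (by omega) hj).2
      exact chordless (vs j) i j (by omega) hj hlt ⟨h ▸ hmem, hmem⟩
    · rw [vert_left i (by omega), vert_right (i + 1) (by omega) hj] at h
      have hlab : extLabel ℓ α i = extLabel ℓ α (i + 1) := congrArg Prod.fst h
      rcases (by omega : i + 1 ≤ ℓ ∨ i = ℓ) with hi | rfl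
      · refine disj i hi (vs (i + 2)) ?_ (mem_coset_self _ _)
        rw [hlab, Set.inter_self]
        exact step (i + 1) (by omega) hi
      · obtain ⟨k, rfl⟩ : ∃ k, i = k + 1 := ⟨i - 1, by omega⟩
        refine disj k le_rfl (vs (k + 1)) (mem_coset_self _ _) ?_
        rw [← hlab, Set.inter_self]
        exact mem_coset_symm (step (k + 1) hℓ le_rfl)
  refine ⟨fun i j hi hj hij => ?_, fun k hk => ?_, consecutive, chordless⟩
  · rcases Nat.lt_or_gt_of_ne hij with h | h
    · exact distinct i j hj h
    · exact (distinct j i hi h).symm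
  · rintro ⟨hsub, -, heq⟩
    by_cases hk' : 1 ≤ k ∧ k ≤ ℓ
    · rw [vert_right k hk'.1 hk, label_of_mem k hk'.1 hk'.2] at hsub heq
      exact ht k hk'.1 hk'.2 ((coset_mono hsub).trans heq.symm.subset)
    · have hempty : (pathVert ℓ vs α k).1 = ∅ := by
        rcases (by omega : k = 0 ∨ k = ℓ + 1) with rfl | rfl <;> simp [pathVert]
      exact hγ_ne (Set.subset_empty_iff.mp (hempty ▸ hsub))
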